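/- arXiv:math/0004104 — 2 statements merged into one kernel-verified Lean document; each statement's English description precedes it below -/
import Mathlib

section
/- Let c ≥ 1 and n ≥ 2, and let μ_n be the probability measure on ℂⁿ whose density with respect to Lebesgue measure is proportional to exp(−n Σ_{i=1}^n |z_i|²) · (∏_{i=1}^n |z_i|)^{2(c−1)n} · ∏_{1≤i<j≤n} |z_i − z_j|². Let μ_n^{(1)} and μ_n^{(2)} be the marginals of μ_n on the first coordinate and on the first two coordinates, respectively. Then the total variation norm of the signed measure μ_n^{(2)} − μ_n^{(1)} ⊗ μ_n^{(1)} on ℂ² is at most 2/(n−1). -/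
open MeasureTheory

open scoped ComplexConjugate

section Combinatorics

variable {ι : Type*} [DecidableEq ι]

theorem exists_perm_apply_eq_apply_eq {a b k l : ι} (hab : a ≠ b) (hkl : k ≠ l) :
    ∃ π : Equiv.Perm ι, π a = k ∧ π b = l := by
  have hb : Equiv.swap a k b ≠ k := fun h => hab <| by
    simpa using congrArg (Equiv.swap a k) h.symm
  refine ⟨Equiv.swap (Equiv.swap a k b) l * Equiv.swap a k, ?_, ?_⟩
  · simp only [Equiv.Perm.mul_apply, Equiv.swap_apply_left]
    exact Equiv.swap_apply_of_ne_of_ne hb.symm hkl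
  · simp

theorem perm_eq_one_or_eq_swap {a b : ι} (ρ : Equiv.Perm ι)
    (h : ∀ i, i ≠ a → i ≠ b → ρ i = i) : ρ = 1 ∨ ρ = Equiv.swap a b := by
  by_cases ha : ρ a = a
  · left
    have hb : ρ b = b := by
      by_contra hb
      by_cases h1 : ρ b = a
      · rw [← ha] at h1
        exact hb (by rw [ρ.injective h1, ha])
      · exact hb (ρ.injective (h _ h1 hb))
    ext i
    by_cases hia : i = a
    · simp [hia, ha]
    by_cases hib : i = b
    · simp [hib, hb]
    simp [h i hia hib]
  · right
    have hab : ρ a = b := by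
      by_contra h1
      exact ha (ρ.injective (h _ ha h1))
    have hb : ρ b = a := by
      by_contra h1
      by_cases h2 : ρ b = b
      · exact ha (ρ.injective (by rw [hab, h2]))
      · have := ρ.injective (h _ h1 h2)
        exact h2 this
    ext i
    by_cases hia : i = a
    · simp [hia, hab]
    by_cases hib : i = b
    · simp [hib, hb]
    simp [h i hia hib, Equiv.swap_apply_of_ne_of_ne hia hib]

variable [Fintype ι]

theorem card_perm_apply_eq_apply_eq {a b k l : ι} (hab : a ≠ b) (hkl : k ≠ l) :
    (Finset.univ.filter fun σ : Equiv.Perm ι => σ a = k ∧ σ b = l).card =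
      (Finset.univ.filter fun σ : Equiv.Perm ι => σ a = a ∧ σ b = b).card := by
  obtain ⟨π, rfl, rfl⟩ := exists_perm_apply_eq_apply_eq hab hkl
  symm
  refine Finset.card_bij' (fun σ _ => π * σ) (fun σ _ => π⁻¹ * σ) ?_ ?_ ?_ ?_ <;>
    intro σ <;> simp +contextual [Equiv.Perm.mul_apply]

theorem sum_perm_apply_apply {a b : ι} (hab : a ≠ b) (F : ι → ι → ℂ) (hF : ∀ k, F k k = 0) :
    ∑ σ : Equiv.Perm ι, F (σ a) (σ b) =
      ((Finset.univ.filter fun σ : Equiv.Perm ι => σ a = a ∧ σ b = b).card : ℂ) *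
        ∑ k, ∑ l, F k l := by
  have h (σ : Equiv.Perm ι) : F (σ a) (σ b) =
      ∑ k, ∑ l, if σ a = k ∧ σ b = l then F k l else 0 := by
    simp [ite_and]
  simp_rw [h]
  rw [Finset.sum_comm, Finset.mul_sum]
  refine Finset.sum_congr rfl fun k _ => ?_
  rw [Finset.sum_comm, Finset.mul_sum]
  refine Finset.sum_congr rfl fun l _ => ?_
  rw [← Finset.sum_filter, Finset.sum_const, nsmul_eq_mul]
  rcases eq_or_ne k l with rfl | hkl
  · simp [hF]
  · rw [card_perm_apply_eq_apply_eq hab hkl]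

theorem sum_perm_sign_mul_prod_of_eq_one {a b : ι} (hab : a ≠ b) (G : ι → ι → ι → ℂ)
    (hG : ∀ i, i ≠ a → i ≠ b → ∀ k l, G i k l = if k = l then 1 else 0) :
    ∑ σ : Equiv.Perm ι, ∑ τ : Equiv.Perm ι,
        ((Equiv.Perm.sign σ : ℤ) : ℂ) * ((Equiv.Perm.sign τ : ℤ) : ℂ) * ∏ i, G i (σ i) (τ i) =
      ((Finset.univ.filter fun σ : Equiv.Perm ι => σ a = a ∧ σ b = b).card : ℂ) *
        ∑ k, ∑ l, (G a k k * G b l l - G a k l * G b l k) := by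
  rw [← sum_perm_apply_apply hab (fun k l => G a k k * G b l l - G a k l * G b l k)
    (fun k => by ring)]
  refine Finset.sum_congr rfl fun σ _ => ?_
  have hprod (H : ι → ℂ) (hH : ∀ i, i ≠ a → i ≠ b → H i = 1) : ∏ i, H i = H a * H b := by
    rw [← Finset.prod_pair hab]
    symm
    refine Finset.prod_subset (Finset.subset_univ _) fun i _ hi => ?_
    simp only [Finset.mem_insert, Finset.mem_singleton, not_or] at hi
    exact hH i hi.1 hi.2
  have hsign : ((Equiv.Perm.sign σ : ℤ) : ℂ) * ((Equiv.Perm.sign σ : ℤ) : ℂ) = 1 := by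
    rcases Int.units_eq_one_or (Equiv.Perm.sign σ) with h | h <;> simp [h]
  have hne : σ ≠ σ * Equiv.swap a b := by
    intro h
    exact hab (by simpa using congrArg (fun τ => σ⁻¹ (τ a)) h)
  rw [← Finset.sum_subset (Finset.subset_univ {σ, σ * Equiv.swap a b}), Finset.sum_pair hne,
    hprod, hprod]
  · simp only [Equiv.Perm.sign_mul, Equiv.Perm.sign_swap hab, Equiv.Perm.mul_apply,
      Equiv.swap_apply_left, Equiv.swap_apply_right]
    push_cast
    linear_combination (G a (σ a) (σ a) * G b (σ b) (σ b) - G a (σ a) (σ b) * G b (σ b) (σ a)) *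
      hsign
  · intro i hia hib
    rw [hG i hia hib]
    simp [Equiv.swap_apply_of_ne_of_ne hia hib]
  · intro i hia hib
    rw [hG i hia hib, if_pos rfl]
  · intro τ _ hτ
    simp only [Finset.mem_insert, Finset.mem_singleton, not_or] at hτ
    obtain ⟨i, hia, hib, hi⟩ : ∃ i, i ≠ a ∧ i ≠ b ∧ σ i ≠ τ i := by
      by_contra! hcon
      rcases perm_eq_one_or_eq_swap (a := a) (b := b) (σ⁻¹ * τ) (fun i hia hib => by
        simp [← hcon i hia hib]) with h | h
      · exact hτ.1 (inv_mul_eq_one.mp h).symm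
      · exact hτ.2 (by rw [← h, mul_inv_cancel_left])
    rw [Finset.prod_eq_zero (Finset.mem_univ i), mul_zero]
    rw [hG i hia hib, if_neg hi]

end Combinatorics

namespace MeasureTheory

theorem totalVariation_toSignedMeasure_sub_le {X : Type*} [MeasurableSpace X]
    (ρ σ α β : Measure X) [IsFiniteMeasure ρ] [IsFiniteMeasure σ] [IsFiniteMeasure α]
    [IsFiniteMeasure β] (h : ρ + β = σ + α) :
    (ρ.toSignedMeasure - σ.toSignedMeasure).totalVariation Set.univ ≤
      α Set.univ + β Set.univ := by
  have hs (i : Set X) (hi : MeasurableSet i) :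
      (ρ.toSignedMeasure - σ.toSignedMeasure) i = α.real i - β.real i := by
    rw [Measure.toSignedMeasure_sub_apply hi]
    have : (ρ + β).real i = (σ + α).real i := by rw [h]
    rw [measureReal_add_apply, measureReal_add_apply] at this
    linarith
  obtain ⟨i, hi, hi₂, hi₃, hp, hn⟩ :=
    (ρ.toSignedMeasure - σ.toSignedMeasure).toJordanDecomposition_spec
  rw [SignedMeasure.totalVariation, Measure.add_apply, hp, hn]
  refine add_le_add ?_ ?_
  · rw [← ENNReal.toReal_le_toReal (measure_ne_top _ _) (measure_ne_top _ _), ← measureReal_def,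
      ← measureReal_def, SignedMeasure.toMeasureOfZeroLE_real_apply _ _ _ .univ,
      Set.inter_univ, hs i hi]
    linarith [measureReal_mono (μ := α) (Set.subset_univ i), measureReal_nonneg (μ := β) (s := i)]
  · rw [← ENNReal.toReal_le_toReal (measure_ne_top _ _) (measure_ne_top _ _), ← measureReal_def,
      ← measureReal_def, SignedMeasure.toMeasureOfLEZero_real_apply _ _ _ .univ,
      Set.inter_univ, hs _ hi.compl]
    linarith [measureReal_mono (μ := β) (Set.subset_univ iᶜ),
      measureReal_nonneg (μ := α) (s := iᶜ)]

section Determinantal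

variable {X ι : Type*} [Fintype ι]

theorem norm_sum_mul_conj_sq (φ : ι → X → ℂ) (p : X × X) :
    ((‖∑ k, φ k p.1 * conj (φ k p.2)‖ ^ 2 : ℝ) : ℂ) =
      ∑ k, ∑ l, (φ k p.1 * conj (φ l p.1)) * (φ l p.2 * conj (φ k p.2)) := by
  push_cast
  rw [← Complex.mul_conj', map_sum, Finset.sum_mul_sum]
  refine Finset.sum_congr rfl fun k _ => Finset.sum_congr rfl fun l _ => ?_
  simp only [map_mul, Complex.conj_conj]
  ring

theorem norm_det_sq [DecidableEq ι] (φ : ι → X → ℂ) (z : ι → X) :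
    ((‖(Matrix.of fun k i => φ k (z i)).det‖ ^ 2 : ℝ) : ℂ) =
      ∑ σ : Equiv.Perm ι, ∑ τ : Equiv.Perm ι,
        ((Equiv.Perm.sign σ : ℤ) : ℂ) * ((Equiv.Perm.sign τ : ℤ) : ℂ) *
          ∏ i, φ (σ i) (z i) * conj (φ (τ i) (z i)) := by
  push_cast
  rw [← Complex.mul_conj', Matrix.det_apply', map_sum, Finset.sum_mul_sum]
  refine Finset.sum_congr rfl fun σ _ => Finset.sum_congr rfl fun τ _ => ?_
  simp only [Matrix.of_apply, map_mul, map_prod, map_intCast, Finset.prod_mul_distrib]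
  ring

variable [MeasurableSpace X]

theorem real_withDensity_ofReal {Y : Type*} [MeasurableSpace Y] {m : Measure Y} {f : Y → ℝ}
    (hf : Integrable f m) (hf0 : 0 ≤ f) {S : Set Y} (hS : MeasurableSet S) :
    (m.withDensity fun y => ENNReal.ofReal (f y)).real S = ∫ y in S, f y ∂m := by
  rw [measureReal_def, withDensity_apply _ hS,
    integral_eq_lintegral_of_nonneg_ae (.of_forall hf0) hf.1.restrict]

/-- The Gram matrix on `S` of a family of functions. -/
noncomputable def overlap (m : Measure X) (φ : ι → X → ℂ) (S : Set X) (k l : ι) : ℂ :=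
  ∫ x in S, φ k x * conj (φ l x) ∂m

section Kernel

variable {m : Measure X} {φ : ι → X → ℂ}

theorem integrable_norm_sum_mul_conj_sq [SFinite m]
    (hφ : ∀ k l, Integrable (fun x => φ k x * conj (φ l x)) m) :
    Integrable (fun p : X × X => ‖∑ k, φ k p.1 * conj (φ k p.2)‖ ^ 2) (m.prod m) := by
  suffices h : Integrable (fun p : X × X =>
      ((‖∑ k, φ k p.1 * conj (φ k p.2)‖ ^ 2 : ℝ) : ℂ)) (m.prod m) from h.re
  simp_rw [norm_sum_mul_conj_sq]
  exact integrable_finsetSum _ fun k _ => integrable_finsetSum _ fun l _ =>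
    (hφ k l).mul_prod (hφ l k)

theorem setIntegral_norm_sum_mul_conj_sq [SFinite m]
    (hφ : ∀ k l, Integrable (fun x => φ k x * conj (φ l x)) m) (S T : Set X) :
    ((∫ p in S ×ˢ T, ‖∑ k, φ k p.1 * conj (φ k p.2)‖ ^ 2 ∂m.prod m : ℝ) : ℂ) =
      ∑ k, ∑ l, overlap m φ S k l * overlap m φ T l k := by
  have hi (k l : ι) : Integrable (fun p : X × X =>
      (φ k p.1 * conj (φ l p.1)) * (φ l p.2 * conj (φ k p.2))) ((m.prod m).restrict (S ×ˢ T)) :=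
    ((hφ k l).mul_prod (hφ l k)).restrict
  rw [← integral_complex_ofReal]
  simp_rw [norm_sum_mul_conj_sq]
  rw [integral_finsetSum _ fun k _ => integrable_finsetSum _ fun l _ => hi k l]
  refine Finset.sum_congr rfl fun k _ => ?_
  rw [integral_finsetSum _ fun l _ => hi k l]
  refine Finset.sum_congr rfl fun l _ => ?_
  exact setIntegral_prod_mul (fun x => φ k x * conj (φ l x)) (fun x => φ l x * conj (φ k x)) S T

end Kernel

variable [DecidableEq ι]

variable {m : Measure X} [SigmaFinite m] {φ : ι → X → ℂ}

theorem integrable_norm_det_sq (hφ : ∀ k l, Integrable (fun x => φ k x * conj (φ l x)) m) :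
    Integrable (fun z : ι → X => ‖(Matrix.of fun k i => φ k (z i)).det‖ ^ 2)
      (Measure.pi fun _ => m) := by
  suffices h : Integrable (fun z : ι → X =>
      ((‖(Matrix.of fun k i => φ k (z i)).det‖ ^ 2 : ℝ) : ℂ)) (Measure.pi fun _ => m) from h.re
  simp_rw [norm_det_sq]
  exact integrable_finsetSum _ fun σ _ => integrable_finsetSum _ fun τ _ =>
    (Integrable.fintype_prod (f := fun i x => φ (σ i) x * conj (φ (τ i) x))
      fun i => hφ _ _).const_mul _

theorem setIntegral_norm_det_sq (hφ : ∀ k l, Integrable (fun x => φ k x * conj (φ l x)) m)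
    (A : ι → Set X) :
    ((∫ z in Set.univ.pi A, ‖(Matrix.of fun k i => φ k (z i)).det‖ ^ 2
        ∂Measure.pi fun _ => m : ℝ) : ℂ) =
      ∑ σ : Equiv.Perm ι, ∑ τ : Equiv.Perm ι,
        ((Equiv.Perm.sign σ : ℤ) : ℂ) * ((Equiv.Perm.sign τ : ℤ) : ℂ) *
          ∏ i, overlap m φ (A i) (σ i) (τ i) := by
  have hi (σ τ : Equiv.Perm ι) : Integrable (fun z : ι → X =>
      ((Equiv.Perm.sign σ : ℤ) : ℂ) * ((Equiv.Perm.sign τ : ℤ) : ℂ) *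
          ∏ i, φ (σ i) (z i) * conj (φ (τ i) (z i)))
      ((Measure.pi fun _ => m).restrict (Set.univ.pi A)) :=
    ((Integrable.fintype_prod (f := fun i x => φ (σ i) x * conj (φ (τ i) x))
      fun i => hφ _ _).const_mul _).restrict
  rw [← integral_complex_ofReal]
  simp_rw [norm_det_sq]
  rw [integral_finsetSum _ fun σ _ => integrable_finsetSum _ fun τ _ => hi σ τ]
  refine Finset.sum_congr rfl fun σ _ => ?_
  rw [integral_finsetSum _ fun τ _ => hi σ τ]
  refine Finset.sum_congr rfl fun τ _ => ?_
  rw [integral_const_mul, Measure.restrict_pi_pi]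
  congr 1
  exact integral_fintype_prod_eq_prod (fun i x => φ (σ i) x * conj (φ (τ i) x))

/-- The two-point marginal of a determinantal density is, up to a constant, a sum of
`2 × 2` minors of Gram matrices. -/
theorem setIntegral_norm_det_sq_of_orthonormal
    (hφ : ∀ k l, Integrable (fun x => φ k x * conj (φ l x)) m)
    (ho : ∀ k l, ∫ x, φ k x * conj (φ l x) ∂m = if k = l then 1 else 0)
    {a b : ι} (hab : a ≠ b) (S T : Set X) :
    ((∫ z in (fun z : ι → X => (z a, z b)) ⁻¹' S ×ˢ T,
        ‖(Matrix.of fun k i => φ k (z i)).det‖ ^ 2 ∂Measure.pi fun _ => m : ℝ) : ℂ) =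
      ((Finset.univ.filter fun σ : Equiv.Perm ι => σ a = a ∧ σ b = b).card : ℂ) *
        ∑ k, ∑ l, (overlap m φ S k k * overlap m φ T l l -
          overlap m φ S k l * overlap m φ T l k) := by
  let A : ι → Set X := fun i => if i = a then S else if i = b then T else Set.univ
  have hA : (fun z : ι → X => (z a, z b)) ⁻¹' S ×ˢ T = Set.univ.pi A := by
    ext z
    simp only [Set.mem_preimage, Set.mem_prod, Set.mem_univ_pi, A]
    constructor
    · rintro ⟨h1, h2⟩ i
      split_ifs with h3 h4
      · exact h3 ▸ h1
      · exact h4 ▸ h2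
      · trivial
    · intro h
      exact ⟨by simpa using h a, by simpa [hab.symm] using h b⟩
  rw [hA, setIntegral_norm_det_sq hφ,
    sum_perm_sign_mul_prod_of_eq_one hab (fun i k l => overlap m φ (A i) k l)]
  · simp [A, hab.symm]
  · intro i hia hib k l
    simp [A, hia, hib, overlap, ho]

theorem totalVariation_marginal_sub_prod_le
    (hφ : ∀ k l, Integrable (fun x => φ k x * conj (φ l x)) m)
    (ho : ∀ k l, ∫ x, φ k x * conj (φ l x) ∂m = if k = l then 1 else 0)
    {a b : ι} (hab : a ≠ b) {K : ℝ} (hK : 0 ≤ K) {μ : Measure (ι → X)} [IsProbabilityMeasure μ]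
    (hμ : μ = (Measure.pi fun _ => m).withDensity fun z =>
      ENNReal.ofReal (K * ‖(Matrix.of fun k i => φ k (z i)).det‖ ^ 2))
    {ν₂ : Measure (X × X)} (hν₂ : ν₂ = μ.map fun z => (z a, z b))
    {ν₁ : Measure X} (hν₁ : ν₁ = μ.map fun z => z a)
    [IsFiniteMeasure ν₂] [IsFiniteMeasure (ν₁.prod ν₁)] :
    (ν₂.toSignedMeasure - (ν₁.prod ν₁).toSignedMeasure).totalVariation Set.univ ≤
      ENNReal.ofReal (2 / ((Fintype.card ι : ℝ) - 1)) := by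
  set n : ℝ := (Fintype.card ι : ℝ) with hn
  have hnC : (n : ℂ) = (Fintype.card ι : ℂ) := by simp [hn]
  have hn2 : 2 ≤ n := by
    rw [hn]
    exact_mod_cast Fintype.one_lt_card_iff.mpr ⟨a, b, hab⟩
  have : IsProbabilityMeasure ν₁ := hν₁ ▸ 
    Measure.isProbabilityMeasure_map (measurable_pi_apply a).aemeasurable
  have hov (k l : ι) : overlap m φ Set.univ k l = if k = l then 1 else 0 := by
    simp [overlap, ho]
  obtain ⟨C, hC⟩ : ∃ C : ℝ, ∀ S T : Set X, MeasurableSet S → MeasurableSet T →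
      (ν₂.real (S ×ˢ T) : ℂ) = C * ∑ k, ∑ l, (overlap m φ S k k * overlap m φ T l l -
          overlap m φ S k l * overlap m φ T l k) := by
    refine ⟨K * (Finset.univ.filter fun σ : Equiv.Perm ι => σ a = a ∧ σ b = b).card,
      fun S T hS hT => ?_⟩
    rw [hν₂, map_measureReal_apply (by fun_prop) (hS.prod hT), hμ,
      real_withDensity_ofReal ((integrable_norm_det_sq hφ).const_mul K)
        (fun z => by positivity) ((hS.prod hT).preimage (by fun_prop)),
      integral_const_mul, Complex.ofReal_mul, setIntegral_norm_det_sq_of_orthonormal hφ ho hab]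
    push_cast
    ring
  have hone (S : Set X) (hS : MeasurableSet S) : ν₁.real S = ν₂.real (S ×ˢ Set.univ) := by
    rw [hν₂, hν₁, map_measureReal_apply (by fun_prop) hS,
      map_measureReal_apply (by fun_prop) (hS.prod .univ)]
    congr 1
    ext z
    simp
  have hone' (S : Set X) (hS : MeasurableSet S) :
      (ν₁.real S : ℂ) = C * ((n - 1) * ∑ k, overlap m φ S k k) := by
    rw [hone S hS, hC S _ hS .univ]
    congr 1
    simp [hov, Finset.sum_sub_distrib, hnC, ← Finset.mul_sum]
    ring
  have hCn : C * (n * (n - 1)) = 1 := by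
    have := hone' Set.univ .univ
    simp only [hov, probReal_univ] at this
    have h2 : ((C * (n * (n - 1)) : ℝ) : ℂ) = 1 := by
      rw [← Complex.ofReal_one, this]
      simp only [if_true, Finset.sum_const, Finset.card_univ, nsmul_eq_mul, hnC]
      push_cast
      rw [hnC]
      ring
    exact_mod_cast h2
  have hC0 : 0 ≤ C := by
    by_contra! h
    have : 0 < n * (n - 1) := by nlinarith
    nlinarith
  set β : Measure (X × X) := (m.prod m).withDensity fun p =>
    ENNReal.ofReal (C * ‖∑ k, φ k p.1 * conj (φ k p.2)‖ ^ 2) with hβ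
  have hβi := (integrable_norm_sum_mul_conj_sq hφ).const_mul C
  have : IsFiniteMeasure β := isFiniteMeasure_withDensity_ofReal hβi.2
  have hβr (S T : Set X) (hS : MeasurableSet S) (hT : MeasurableSet T) :
      (β.real (S ×ˢ T) : ℂ) = C * ∑ k, ∑ l, overlap m φ S k l * overlap m φ T l k := by
    rw [hβ, real_withDensity_ofReal hβi (fun p => by positivity) (hS.prod hT),
      integral_const_mul, Complex.ofReal_mul, setIntegral_norm_sum_mul_conj_sq hφ]
  have hβu : β.real Set.univ = 1 / (n - 1) := by
    have h1 := hβr Set.univ Set.univ .univ .univ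
    rw [Set.univ_prod_univ] at h1
    have h2 : (β.real Set.univ : ℂ) = ((C * n : ℝ) : ℂ) := by
      rw [h1]
      simp [hov, hn]
    have h3 : β.real Set.univ = C * n := by exact_mod_cast h2
    rw [h3, eq_div_iff (by linarith)]
    linarith
  have hn1' : 0 ≤ 1 / (n - 1) := div_nonneg zero_le_one (by linarith)
  set α : Measure (X × X) := ENNReal.ofReal (1 / (n - 1)) • ν₁.prod ν₁ with hα
  have : IsFiniteMeasure α := Measure.smul_finite _ ENNReal.ofReal_ne_top
  have hadd : ν₂ + β = ν₁.prod ν₁ + α := by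
    refine Measure.ext_prod fun {S T} hS hT => ?_
    rw [← ENNReal.toReal_eq_toReal_iff' (measure_ne_top _ _) (measure_ne_top _ _),
      ← measureReal_def, ← measureReal_def, measureReal_add_apply, measureReal_add_apply,
      hα, measureReal_ennreal_smul_apply, ENNReal.toReal_ofReal hn1',
      measureReal_prod_prod, ← Complex.ofReal_inj]
    have hn1 : (n : ℂ) - 1 ≠ 0 := by
      rw [← Complex.ofReal_one, ← Complex.ofReal_sub, Complex.ofReal_ne_zero]
      linarith
    have hCn' : (C : ℂ) * (n * (n - 1)) = 1 := by exact_mod_cast hCn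
    push_cast
    rw [hC S T hS hT, hβr S T hS hT, hone' S hS, hone' T hT]
    simp_rw [Finset.sum_sub_distrib, ← Finset.mul_sum, ← Finset.sum_mul]
    field_simp
    linear_combination
      -(C * (∑ k, overlap m φ S k k) * ∑ l, overlap m φ T l l : ℂ) * hCn'
  refine (totalVariation_toSignedMeasure_sub_le _ _ _ _ hadd).trans ?_
  rw [hα, Measure.smul_apply, measure_univ, smul_eq_mul, mul_one,
    ← ofReal_measureReal (μ := β), hβu, ← ENNReal.ofReal_add]
  · refine (congrArg _ ?_).le
    ring
  all_goals exact hn1'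

end Determinantal


section RadialWeight

/-- The radial weight `exp (-b |z|²) |z|^s` on `ℂ`. -/
noncomputable def radialWeight (b s : ℝ) (z : ℂ) : ℝ :=
  Real.exp (-b * ‖z‖ ^ 2) * ‖z‖ ^ s

theorem radialWeight_nonneg (b s : ℝ) (z : ℂ) : 0 ≤ radialWeight b s z := by
  unfold radialWeight
  positivity

theorem measurable_radialWeight (b s : ℝ) : Measurable (radialWeight b s) := by
  unfold radialWeight
  fun_prop

theorem prod_radialWeight {ι : Type*} [Fintype ι] (b s : ℝ) (z : ι → ℂ) :
    ∏ i, radialWeight b s (z i) =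
      Real.exp (-b * ∑ i, ‖z i‖ ^ 2) * (∏ i, ‖z i‖) ^ s := by
  simp only [radialWeight]
  rw [Finset.prod_mul_distrib, ← Real.exp_sum, Finset.mul_sum,
    Real.finsetProd_rpow _ _ fun i _ => norm_nonneg _]

theorem integral_radialWeight_mul_norm_pow_pos {b s : ℝ} (hb : 0 < b) (hs : 0 ≤ s) (k : ℕ) :
    0 < ∫ z : ℂ, radialWeight b s z * ‖z‖ ^ k := by
  have h := Complex.integral_rpow_mul_exp_neg_mul_rpow (p := 2) (q := s + k) (b := b)
    one_le_two (by have : (0 : ℝ) ≤ k := k.cast_nonneg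
                   linarith) hb
  have heq : ∫ z : ℂ, radialWeight b s z * ‖z‖ ^ k =
      ∫ z : ℂ, ‖z‖ ^ (s + k) * Real.exp (-b * ‖z‖ ^ (2 : ℝ)) := by
    refine integral_congr_ae ?_
    filter_upwards [(measure_eq_zero_iff_ae_notMem (s := {(0 : ℂ)})).mp (by simp)] with z hz
    have hz' : 0 < ‖z‖ := norm_pos_iff.mpr hz
    rw [Real.rpow_add hz', Real.rpow_natCast, Real.rpow_two, radialWeight]
    ring
  rw [heq, h]
  have : 0 < Real.Gamma ((s + k + 2) / 2) := Real.Gamma_pos_of_pos (by positivity)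
  positivity

theorem integrable_radialWeight_mul {b s : ℝ} (hb : 0 < b) (hs : 0 ≤ s) (k l : ℕ) :
    Integrable fun z : ℂ => (radialWeight b s z : ℂ) * (z ^ k * conj z ^ l) := by
  have h : Integrable fun z : ℂ => radialWeight b s z * ‖z‖ ^ (k + l) := by
    by_contra h
    exact (integral_radialWeight_mul_norm_pow_pos hb hs (k + l)).ne' (integral_undef h)
  refine h.mono' ?_ (.of_forall fun z => ?_)
  · have := measurable_radialWeight b s
    exact (by fun_prop : Measurable fun z : ℂ =>
      (radialWeight b s z : ℂ) * (z ^ k * conj z ^ l)).aestronglyMeasurable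
  · simp [abs_of_nonneg (radialWeight_nonneg b s z), pow_add]

theorem integral_radialWeight_mul_of_ne (b s : ℝ) {k l : ℕ} (hkl : k ≠ l) :
    ∫ z : ℂ, (radialWeight b s z : ℂ) * (z ^ k * conj z ^ l) = 0 := by
  have hkl' : (k : ℂ) - l ≠ 0 := sub_ne_zero.mpr (by exact_mod_cast hkl)
  set θ : ℝ := Real.pi / (k - l) with hθ
  have hω : (Circle.exp θ : ℂ) ^ k * conj (Circle.exp θ : ℂ) ^ l = -1 := by
    rw [Circle.coe_exp, ← Complex.exp_conj, ← Complex.exp_nat_mul, ← Complex.exp_nat_mul,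
      ← Complex.exp_add, ← Complex.exp_pi_mul_I, hθ]
    congr 1
    simp only [map_mul, Complex.conj_ofReal, Complex.conj_I]
    push_cast
    field_simp
    ring
  have h := (rotation (Circle.exp θ)).measurePreserving.integral_comp
    (rotation (Circle.exp θ)).toHomeomorph.measurableEmbedding
    (fun z : ℂ => (radialWeight b s z : ℂ) * (z ^ k * conj z ^ l))
  have h2 (z : ℂ) : (radialWeight b s (rotation (Circle.exp θ) z) : ℂ) *
      (rotation (Circle.exp θ) z ^ k * conj (rotation (Circle.exp θ) z) ^ l) =
      -((radialWeight b s z : ℂ) * (z ^ k * conj z ^ l)) := by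
    have hw : radialWeight b s (rotation (Circle.exp θ) z) = radialWeight b s z := by
      simp only [radialWeight, LinearIsometryEquiv.norm_map]
    rw [hw]
    simp only [rotation_apply, map_mul, mul_pow]
    linear_combination ((radialWeight b s z : ℂ) * (z ^ k * conj z ^ l)) * hω
  simp_rw [h2, integral_neg] at h
  exact self_eq_neg.mp h.symm

/-- The normalized monomials with respect to a radial weight. -/
noncomputable def radialMonomial (b s : ℝ) (k : ℕ) (z : ℂ) : ℂ :=
  ((√(∫ w : ℂ, radialWeight b s w * ‖w‖ ^ (2 * k)))⁻¹ : ℝ) *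
    ((√(radialWeight b s z) : ℝ) * z ^ k)

theorem radialMonomial_mul_conj (b s : ℝ) (k l : ℕ) (z : ℂ) :
    radialMonomial b s k z * conj (radialMonomial b s l z) =
      ((√(∫ w : ℂ, radialWeight b s w * ‖w‖ ^ (2 * k)))⁻¹ : ℝ) *
        ((√(∫ w : ℂ, radialWeight b s w * ‖w‖ ^ (2 * l)))⁻¹ : ℝ) *
          ((radialWeight b s z : ℂ) * (z ^ k * conj z ^ l)) := by
  have h : ((√(radialWeight b s z) : ℝ) : ℂ) * (√(radialWeight b s z) : ℝ) =
      radialWeight b s z := by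
    rw [← Complex.ofReal_mul, Real.mul_self_sqrt (radialWeight_nonneg b s z)]
  simp only [radialMonomial, map_mul, Complex.conj_ofReal, map_pow]
  rw [← h]
  ring

theorem integrable_radialMonomial_mul_conj {b s : ℝ} (hb : 0 < b) (hs : 0 ≤ s) (k l : ℕ) :
    Integrable fun z : ℂ => radialMonomial b s k z * conj (radialMonomial b s l z) := by
  simp_rw [radialMonomial_mul_conj]
  exact (integrable_radialWeight_mul hb hs k l).const_mul _

theorem integral_radialMonomial_mul_conj {b s : ℝ} (hb : 0 < b) (hs : 0 ≤ s) (k l : ℕ) :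
    ∫ z : ℂ, radialMonomial b s k z * conj (radialMonomial b s l z) =
      if k = l then 1 else 0 := by
  simp_rw [radialMonomial_mul_conj, integral_const_mul]
  split_ifs with hkl
  · subst hkl
    have hpos := integral_radialWeight_mul_norm_pow_pos hb hs (2 * k)
    have h : ∫ z : ℂ, (radialWeight b s z : ℂ) * (z ^ k * conj z ^ k) =
        ((∫ z : ℂ, radialWeight b s z * ‖z‖ ^ (2 * k) : ℝ) : ℂ) := by
      rw [← integral_complex_ofReal]
      refine integral_congr_ae (.of_forall fun z => ?_)
      simp only [← mul_pow, Complex.mul_conj', pow_mul]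
      push_cast
      rfl
    rw [h, ← Complex.ofReal_mul, ← Complex.ofReal_mul, ← mul_inv, Real.mul_self_sqrt hpos.le,
      inv_mul_cancel₀ hpos.ne', Complex.ofReal_one]
  · rw [integral_radialWeight_mul_of_ne b s hkl, mul_zero]

theorem norm_det_radialMonomial_sq (b s : ℝ) {n : ℕ} (z : Fin n → ℂ) :
    ‖(Matrix.of fun k i : Fin n => radialMonomial b s k (z i)).det‖ ^ 2 =
      (∏ k : Fin n, ∫ w : ℂ, radialWeight b s w * ‖w‖ ^ (2 * (k : ℕ)))⁻¹ *
        ((∏ i, radialWeight b s (z i)) * ∏ i, ∏ j ∈ Finset.Ioi i, ‖z i - z j‖ ^ 2) := by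
  have h0 (k : ℕ) : 0 ≤ ∫ w : ℂ, radialWeight b s w * ‖w‖ ^ (2 * k) :=
    integral_nonneg fun w => mul_nonneg (radialWeight_nonneg b s w) (by positivity)
  have h : (Matrix.of fun k i : Fin n => radialMonomial b s k (z i)).det =
      (∏ k : Fin n, (((√(∫ w : ℂ, radialWeight b s w * ‖w‖ ^ (2 * (k : ℕ))))⁻¹ : ℝ) : ℂ)) *
        ((∏ i, ((√(radialWeight b s (z i)) : ℝ) : ℂ)) * (Matrix.vandermonde z).det) := by
    rw [← Matrix.det_transpose (Matrix.vandermonde z), ← Matrix.det_mul_row,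
      ← Matrix.det_mul_column]
    rfl
  rw [h, Matrix.det_vandermonde]
  simp only [norm_mul, norm_prod, mul_pow, ← Finset.prod_pow, Complex.norm_real,
    Real.norm_eq_abs, sq_abs, inv_pow, Real.sq_sqrt (h0 _),
    Real.sq_sqrt (radialWeight_nonneg _ _ _), Finset.prod_inv_distrib]
  simp only [norm_sub_rev]

end RadialWeight

end MeasureTheory

/-- for the probability measure `μ` on `ℂⁿ` (`n ≥ 2`) with density proportional
to `exp(-n Σ|zᵢ|²) (∏|zᵢ|)^{2(c-1)n} ∏_{i<j}|zᵢ-zⱼ|²`, the total variation norm of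
`μ⁽²⁾ − μ⁽¹⁾ ⊗ μ⁽¹⁾` is at most `2/(n-1)`. -/
theorem stmt_18 (c : ℝ) (hc : 1 ≤ c) (n : ℕ) (hn : 2 ≤ n)
    (μ : Measure (Fin n → ℂ)) [IsProbabilityMeasure μ]
    (K : ℝ) (hK : 0 < K)
    (hμ : μ = volume.withDensity (fun z : Fin n → ℂ =>
      ENNReal.ofReal (K * Real.exp (-(n : ℝ) * ∑ i, ‖z i‖ ^ 2) *
        (∏ i, ‖z i‖) ^ (2 * (c - 1) * (n : ℝ)) *
        ∏ i, ∏ j ∈ Finset.Ioi i, ‖z i - z j‖ ^ 2)))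
    (ν₂ : Measure (ℂ × ℂ))
    (hν₂ : ν₂ = Measure.map (fun z : Fin n → ℂ => (z ⟨0, by omega⟩, z ⟨1, by omega⟩)) μ)
    (ν₁ : Measure ℂ)
    (hν₁ : ν₁ = Measure.map (fun z : Fin n → ℂ => z ⟨0, by omega⟩) μ)
    [IsFiniteMeasure ν₂] [IsFiniteMeasure (ν₁.prod ν₁)] :
    (ν₂.toSignedMeasure - (ν₁.prod ν₁).toSignedMeasure).totalVariation Set.univ ≤
      ENNReal.ofReal (2 / ((n : ℝ) - 1)) := by
  have hb : (0 : ℝ) < n := by exact_mod_cast (by omega : 0 < n)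
  have hs : 0 ≤ 2 * (c - 1) * (n : ℝ) := mul_nonneg (by linarith) hb.le
  have hpos : 0 < ∏ k : Fin n, ∫ w : ℂ,
      radialWeight n (2 * (c - 1) * (n : ℝ)) w * ‖w‖ ^ (2 * (k : ℕ)) :=
    Finset.prod_pos fun k _ => integral_radialWeight_mul_norm_pow_pos hb hs _
  have h := totalVariation_marginal_sub_prod_le (m := (volume : Measure ℂ))
    (φ := fun k : Fin n => radialMonomial n (2 * (c - 1) * (n : ℝ)) k)
    (fun k l => integrable_radialMonomial_mul_conj hb hs k l)
    (fun k l => by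
      rw [integral_radialMonomial_mul_conj hb hs]
      simp only [Fin.ext_iff])
    (a := ⟨0, by omega⟩) (b := ⟨1, by omega⟩) (by simp)
    (mul_pos hK hpos).le ?_ hν₂ hν₁
  · rwa [Fintype.card_fin] at h
  · rw [hμ, volume_pi]
    congr 1
    ext z
    rw [norm_det_radialMonomial_sq, prod_radialWeight]
    congr 1
    rw [mul_assoc K (∏ k : Fin n, _), mul_inv_cancel_left₀ hpos.ne']
    ring
end

section
/- Let c ≥ 1 and n ∈ ℕ, and let μ_n be the probability measure on ℂⁿ whose density with respect to Lebesgue measure is proportional to exp(−n Σ_{i=1}^n |z_i|²) · (∏_{i=1}^n |z_i|)^{2(c−1)n} · ∏_{1≤i<j≤n} |z_i − z_j|². Then the marginal distribution μ_n^{(1)} of μ_n on the first coordinate has density D_{n,1}(z) = (n^{(c−1)n}/π) · Σ_{k=0}^{n−1} [ n^k |z|^{2(k+(c−1)n)} / Γ(k+(c−1)n+1) ] · e^{−n|z|²} with respect to Lebesgue measure d(Re z)d(Im z) on ℂ. -/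
open MeasureTheory

/-- The Andréief identity: the integral of a product of two determinants against a product
measure, together with its integrability. -/
theorem integrable_and_integral_det_mul_det {ι α : Type*} [Fintype ι] [DecidableEq ι]
    [MeasurableSpace α] (μ : ι → Measure α) [∀ i, SigmaFinite (μ i)] (f g : ι → α → ℂ)
    (hfg : ∀ i j k, Integrable (fun x => f j x * g k x) (μ i)) :
    Integrable (fun x : ι → α => (Matrix.of fun j i => f j (x i)).det *
      (Matrix.of fun j i => g j (x i)).det) (Measure.pi μ) ∧
    ∫ x : ι → α, (Matrix.of fun j i => f j (x i)).det *
      (Matrix.of fun j i => g j (x i)).det ∂(Measure.pi μ) =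
    ∑ σ : Equiv.Perm ι, ∑ τ : Equiv.Perm ι, ((Equiv.Perm.sign σ : ℤ) : ℂ) *
      ((Equiv.Perm.sign τ : ℤ) : ℂ) * ∏ i, ∫ x, f (σ i) x * g (τ i) x ∂(μ i) := by
  have expand : (fun x : ι → α => (Matrix.of fun j i => f j (x i)).det *
      (Matrix.of fun j i => g j (x i)).det) = fun x => ∑ σ : Equiv.Perm ι, ∑ τ : Equiv.Perm ι,
      ((Equiv.Perm.sign σ : ℤ) : ℂ) * ((Equiv.Perm.sign τ : ℤ) : ℂ) *
        ∏ i, f (σ i) (x i) * g (τ i) (x i) := by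
    funext x
    simp only [Matrix.det_apply', Matrix.of_apply, Finset.sum_mul_sum, Finset.prod_mul_distrib]
    refine Finset.sum_congr rfl fun σ _ => Finset.sum_congr rfl fun τ _ => ?_
    ring
  have integrable_term (σ τ : Equiv.Perm ι) : Integrable (fun x : ι → α =>
      ((Equiv.Perm.sign σ : ℤ) : ℂ) * ((Equiv.Perm.sign τ : ℤ) : ℂ) *
        ∏ i, f (σ i) (x i) * g (τ i) (x i)) (Measure.pi μ) :=
    (Integrable.fintype_prod (f := fun i x => f (σ i) x * g (τ i) x)
      fun i => hfg i (σ i) (τ i)).const_mul _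
  rw [expand]
  refine ⟨integrable_finsetSum _ fun σ _ => integrable_finsetSum _ fun τ _ =>
    integrable_term σ τ, ?_⟩
  rw [integral_finsetSum _ fun σ _ => integrable_finsetSum _ fun τ _ => integrable_term σ τ]
  refine Finset.sum_congr rfl fun σ _ => ?_
  rw [integral_finsetSum _ fun τ _ => integrable_term σ τ]
  refine Finset.sum_congr rfl fun τ _ => ?_
  rw [integral_const_mul,
    integral_fintype_prod_eq_prod (fun i x => f (σ i) x * g (τ i) x)]

theorem Equiv.Perm.eq_of_forall_ne_apply_eq {ι : Type*} [Finite ι] {σ τ : Equiv.Perm ι} (a : ι)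
    (h : ∀ i, i ≠ a → σ i = τ i) : σ = τ := by
  have h1 : ∀ i, i ≠ a → (τ⁻¹ * σ) i = i := fun i hi => by simp [h i hi]
  have h2 : (τ⁻¹ * σ) a = a := by
    by_contra hne
    exact hne ((τ⁻¹ * σ).injective (h1 _ hne))
  ext i
  by_cases hi : i = a
  · subst hi
    exact Equiv.Perm.inv_eq_iff_eq.mp h2
  · exact h i hi

theorem Fin.sum_perm_apply_zero {m : ℕ} {R : Type*} [CommSemiring R] (F : Fin (m + 1) → R) :
    ∑ σ : Equiv.Perm (Fin (m + 1)), F (σ 0) = (m.factorial : R) * ∑ k, F k := by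
  rw [← Equiv.Perm.decomposeFin.symm.sum_comp, Fintype.sum_prod_type]
  simp [Finset.mul_sum, Fintype.card_perm]

/-- The first marginal of a biorthogonal ensemble, in integrated form. -/
theorem setIntegral_det_mul_det_of_biorthogonal {α : Type*} [MeasurableSpace α] (μ : Measure α)
    [SigmaFinite μ] {m : ℕ} (f g : Fin (m + 1) → α → ℂ)
    (hfg : ∀ j k, Integrable (fun x => f j x * g k x) μ)
    (horth : ∀ j k, j ≠ k → ∫ x, f j x * g k x ∂μ = 0)
    (hnorm : ∀ k, ∫ x, f k x * g k x ∂μ ≠ 0) (S : Set α) :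
    ∫ x in (Function.eval 0 ⁻¹' S : Set (Fin (m + 1) → α)),
      (Matrix.of fun j i => f j (x i)).det * (Matrix.of fun j i => g j (x i)).det
        ∂(Measure.pi fun _ => μ) =
    m.factorial * (∏ k, ∫ x, f k x * g k x ∂μ) *
      ∑ k, (∫ x in S, f k x * g k x ∂μ) / ∫ x, f k x * g k x ∂μ := by
  rw [← Set.univ_pi_update_univ, Measure.restrict_pi_pi,
    (integrable_and_integral_det_mul_det _ f g fun i j k => (hfg j k).restrict).2]
  have diag (σ : Equiv.Perm (Fin (m + 1))) : ∑ τ : Equiv.Perm (Fin (m + 1)),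
      ((Equiv.Perm.sign σ : ℤ) : ℂ) * ((Equiv.Perm.sign τ : ℤ) : ℂ) *
        ∏ i, ∫ x, f (σ i) x * g (τ i) x
          ∂(μ.restrict (Function.update (fun _ => Set.univ) 0 S i)) =
      (∏ k, ∫ x, f k x * g k x ∂μ) *
        ((∫ x in S, f (σ 0) x * g (σ 0) x ∂μ) / ∫ x, f (σ 0) x * g (σ 0) x ∂μ) := by
    rw [Finset.sum_eq_single σ]
    · have hsign : ((Equiv.Perm.sign σ : ℤ) : ℂ) * ((Equiv.Perm.sign σ : ℤ) : ℂ) = 1 := by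
        rcases Int.units_eq_one_or (Equiv.Perm.sign σ) with h | h <;> simp [h]
      rw [hsign, one_mul, ← Equiv.prod_comp σ fun k => ∫ x, f k x * g k x ∂μ,
        Fin.prod_univ_succ, Fin.prod_univ_succ]
      simp only [Function.update_self, ne_eq, Fin.succ_ne_zero, not_false_eq_true,
        Function.update_of_ne, Measure.restrict_univ]
      field_simp [hnorm (σ 0)]
    · intro τ _ hτ
      obtain ⟨i, hi, hne⟩ : ∃ i, i ≠ 0 ∧ σ i ≠ τ i := by
        by_contra! hall
        exact hτ (Equiv.Perm.eq_of_forall_ne_apply_eq 0 hall).symm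
      rw [Finset.prod_eq_zero (Finset.mem_univ i), mul_zero]
      rw [Function.update_of_ne hi, Measure.restrict_univ, horth _ _ hne]
    · simp
  simp_rw [diag]
  rw [← Finset.mul_sum, Fin.sum_perm_apply_zero fun k =>
    (∫ x in S, f k x * g k x ∂μ) / ∫ x, f k x * g k x ∂μ]
  ring

theorem Complex.integral_radial_mul_pow_mul_conj_pow_eq_zero (w : ℝ → ℂ) {j k : ℕ} (h : j ≠ k) :
    ∫ z : ℂ, w ‖z‖ * z ^ j * (starRingEnd ℂ z) ^ k = 0 := by
  set a : Circle := Circle.exp (Real.pi / ((j : ℝ) - k)) with ha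
  have hjk : (j : ℂ) - k ≠ 0 := sub_ne_zero.mpr (by exact_mod_cast h)
  have hphase : (a : ℂ) ^ j * (starRingEnd ℂ a) ^ k = -1 := by
    rw [← Circle.coe_inv_eq_conj, ← Circle.coe_pow, ← Circle.coe_pow, ← Circle.coe_mul, ha,
      ← Circle.exp_neg, Circle.coe_mul, Circle.coe_pow, Circle.coe_pow, Circle.coe_exp,
      Circle.coe_exp, ← Complex.exp_nat_mul, ← Complex.exp_nat_mul, ← Complex.exp_add,
      ← Complex.exp_pi_mul_I]
    congr 1
    push_cast
    field_simp
    ring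
  have hrot := ((rotation a).measurePreserving).integral_comp
    (rotation a).toHomeomorph.measurableEmbedding
    fun z : ℂ => w ‖z‖ * z ^ j * (starRingEnd ℂ z) ^ k
  have hneg : (fun z : ℂ => w ‖rotation a z‖ * rotation a z ^ j *
      (starRingEnd ℂ (rotation a z)) ^ k) =
      fun z => -(w ‖z‖ * z ^ j * (starRingEnd ℂ z) ^ k) := by
    funext z
    rw [LinearIsometryEquiv.norm_map, rotation_apply, map_mul, mul_pow, mul_pow]
    linear_combination (w ‖z‖ * z ^ j * (starRingEnd ℂ z) ^ k) * hphase
  rw [hneg, integral_neg] at hrot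
  exact self_eq_neg.mp hrot.symm

/-- The moments of the weight `‖z‖ ^ (2 * a) * exp (-b * ‖z‖ ^ 2)` on `ℂ`. -/
theorem Complex.integral_norm_rpow_mul_exp_mul_norm_pow {a b : ℝ} (ha : 0 ≤ a) (hb : 0 < b)
    (k : ℕ) :
    ∫ z : ℂ, ‖z‖ ^ (2 * a) * Real.exp (-b * ‖z‖ ^ 2) * ‖z‖ ^ (2 * k) =
      Real.pi * Real.Gamma (k + a + 1) / b ^ (k + a + 1) := by
  have h := Complex.integral_rpow_mul_exp_neg_mul_rpow (p := 2) (q := 2 * (k + a)) (b := b)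
    (by norm_num) (by have : (0 : ℝ) ≤ k := k.cast_nonneg; linarith) hb
  rw [show (2 * (k + a) + 2) / 2 = k + a + 1 by ring,
    show -(2 * (k + a) + 2) / 2 = -(k + a + 1) by ring, Real.rpow_neg hb.le] at h
  rw [show Real.pi * Real.Gamma (k + a + 1) / b ^ (k + a + 1) =
    2 * Real.pi / 2 * (b ^ (k + a + 1))⁻¹ * Real.Gamma (k + a + 1) by field_simp, ← h]
  congr 1
  funext z
  rw [mul_add, add_comm, Real.rpow_add_of_nonneg (norm_nonneg z) (by positivity) (by positivity),
    Real.rpow_two, show (2 : ℝ) * k = ((2 * k : ℕ) : ℝ) by push_cast; rfl, Real.rpow_natCast]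
  ring

theorem Complex.integral_norm_rpow_mul_exp_mul_norm_pow_pos {a b : ℝ} (ha : 0 ≤ a) (hb : 0 < b)
    (k : ℕ) :
    0 < ∫ z : ℂ, ‖z‖ ^ (2 * a) * Real.exp (-b * ‖z‖ ^ 2) * ‖z‖ ^ (2 * k) := by
  rw [integral_norm_rpow_mul_exp_mul_norm_pow ha hb]
  have := Real.Gamma_pos_of_pos (s := k + a + 1) (by positivity)
  positivity

theorem Complex.integrable_norm_rpow_mul_exp_mul_norm_pow {a b : ℝ} (ha : 0 ≤ a) (hb : 0 < b)
    (k : ℕ) :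
    Integrable fun z : ℂ => ‖z‖ ^ (2 * a) * Real.exp (-b * ‖z‖ ^ 2) * ‖z‖ ^ (2 * k) :=
  not_imp_comm.mp integral_undef (integral_norm_rpow_mul_exp_mul_norm_pow_pos ha hb k).ne'

theorem Complex.integrable_norm_rpow_mul_exp_mul_pow_mul_conj_pow {a b : ℝ} (ha : 0 ≤ a)
    (hb : 0 < b) (j k : ℕ) :
    Integrable fun z : ℂ => ((‖z‖ ^ (2 * a) * Real.exp (-b * ‖z‖ ^ 2) : ℝ) : ℂ) * z ^ j *
      (starRingEnd ℂ z) ^ k := by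
  refine ((integrable_norm_rpow_mul_exp_mul_norm_pow ha hb j).add
    (integrable_norm_rpow_mul_exp_mul_norm_pow ha hb k)).mono' ?_ ?_
  · exact Measurable.aestronglyMeasurable (by fun_prop)
  · refine ae_of_all _ fun z => ?_
    have hw : 0 ≤ ‖z‖ ^ (2 * a) * Real.exp (-b * ‖z‖ ^ 2) := by positivity
    rw [norm_mul, norm_mul, norm_pow, norm_pow, RCLike.norm_conj, Complex.norm_real,
      Real.norm_of_nonneg hw, Pi.add_apply, mul_assoc, ← mul_add]
    refine mul_le_mul_of_nonneg_left ?_ hw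
    rw [mul_comm 2 j, mul_comm 2 k, pow_mul, pow_mul]
    nlinarith [sq_nonneg (‖z‖ ^ j - ‖z‖ ^ k), sq_nonneg (‖z‖ ^ j), sq_nonneg (‖z‖ ^ k)]

theorem Complex.weight_mul_pow_mul_conj_pow (w : ℝ) (z : ℂ) (k : ℕ) :
    (w : ℂ) * z ^ k * (starRingEnd ℂ z) ^ k = ((w * ‖z‖ ^ (2 * k) : ℝ) : ℂ) := by
  rw [mul_assoc, ← mul_pow, Complex.mul_conj, Complex.normSq_eq_norm_sq, pow_mul]
  push_cast
  rfl

/-- The weighted squared Vandermonde determinant as a product of two determinants. -/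
theorem Complex.prod_weight_mul_prod_norm_sub_sq {n : ℕ} (w : ℂ → ℝ) (z : Fin n → ℂ) :
    (((∏ i, w (z i)) * ∏ i, ∏ j ∈ Finset.Ioi i, ‖z i - z j‖ ^ 2 : ℝ) : ℂ) =
      (Matrix.of fun j i : Fin n => (w (z i) : ℂ) * z i ^ (j : ℕ)).det *
        (Matrix.of fun j i : Fin n => (starRingEnd ℂ (z i)) ^ (j : ℕ)).det := by
  have h1 : (Matrix.of fun j i : Fin n => (w (z i) : ℂ) * z i ^ (j : ℕ)).det =
      (∏ i, (w (z i) : ℂ)) * (Matrix.vandermonde z).det := by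
    rw [← Matrix.det_transpose (Matrix.vandermonde z), ← Matrix.det_mul_row]
    rfl
  have h2 : (Matrix.of fun j i : Fin n => (starRingEnd ℂ (z i)) ^ (j : ℕ)).det =
      (Matrix.vandermonde fun i => starRingEnd ℂ (z i)).det := by
    rw [← Matrix.det_transpose]
    rfl
  rw [h1, h2, Matrix.det_vandermonde, Matrix.det_vandermonde, mul_assoc,
    ← Finset.prod_mul_distrib]
  simp_rw [← Finset.prod_mul_distrib, ← map_sub, Complex.mul_conj, Complex.normSq_eq_norm_sq]
  push_cast
  simp_rw [norm_sub_rev]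

/-- The one-point marginal of the determinantal density with radial weight
`‖z‖ ^ (2 * a) * exp (-b * ‖z‖ ^ 2)`, integrated over a set. -/
theorem Complex.setIntegral_weight_mul_prod_norm_sub_sq {a b : ℝ} (ha : 0 ≤ a) (hb : 0 < b)
    (m : ℕ) (S : Set ℂ) :
    ∫ z in (Function.eval 0 ⁻¹' S : Set (Fin (m + 1) → ℂ)),
      (∏ i, (‖z i‖ ^ (2 * a) * Real.exp (-b * ‖z i‖ ^ 2))) *
        ∏ i, ∏ j ∈ Finset.Ioi i, ‖z i - z j‖ ^ 2 =
    m.factorial * (∏ k : Fin (m + 1),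
        ∫ z : ℂ, ‖z‖ ^ (2 * a) * Real.exp (-b * ‖z‖ ^ 2) * ‖z‖ ^ (2 * (k : ℕ))) *
      ∑ k : Fin (m + 1),
        (∫ z in S, ‖z‖ ^ (2 * a) * Real.exp (-b * ‖z‖ ^ 2) * ‖z‖ ^ (2 * (k : ℕ))) /
          ∫ z : ℂ, ‖z‖ ^ (2 * a) * Real.exp (-b * ‖z‖ ^ 2) * ‖z‖ ^ (2 * (k : ℕ)) := by
  have h := setIntegral_det_mul_det_of_biorthogonal (volume : Measure ℂ)
    (fun (k : Fin (m + 1)) z =>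
      ((‖z‖ ^ (2 * a) * Real.exp (-b * ‖z‖ ^ 2) : ℝ) : ℂ) * z ^ (k : ℕ))
    (fun k z => (starRingEnd ℂ z) ^ (k : ℕ))
    (fun j k => integrable_norm_rpow_mul_exp_mul_pow_mul_conj_pow ha hb j k)
    (fun j k hjk => integral_radial_mul_pow_mul_conj_pow_eq_zero
      (fun r => ((r ^ (2 * a) * Real.exp (-b * r ^ 2) : ℝ) : ℂ)) (Fin.val_ne_of_ne hjk))
    (fun k => by
      simp_rw [weight_mul_pow_mul_conj_pow]
      rw [integral_complex_ofReal]
      exact_mod_cast (integral_norm_rpow_mul_exp_mul_norm_pow_pos ha hb k).ne') S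
  simp_rw [weight_mul_pow_mul_conj_pow,
    ← prod_weight_mul_prod_norm_sub_sq fun z => ‖z‖ ^ (2 * a) * Real.exp (-b * ‖z‖ ^ 2),
    integral_complex_ofReal] at h
  exact_mod_cast h

theorem Complex.integrable_weight_mul_prod_norm_sub_sq {a b : ℝ} (ha : 0 ≤ a) (hb : 0 < b)
    (n : ℕ) :
    Integrable fun z : Fin n → ℂ =>
      (∏ i, (‖z i‖ ^ (2 * a) * Real.exp (-b * ‖z i‖ ^ 2))) *
        ∏ i, ∏ j ∈ Finset.Ioi i, ‖z i - z j‖ ^ 2 := by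
  have h := (integrable_and_integral_det_mul_det (fun _ : Fin n => (volume : Measure ℂ))
    (fun (k : Fin n) z => ((‖z‖ ^ (2 * a) * Real.exp (-b * ‖z‖ ^ 2) : ℝ) : ℂ) * z ^ (k : ℕ))
    (fun k z => (starRingEnd ℂ z) ^ (k : ℕ))
    (fun _ j k => integrable_norm_rpow_mul_exp_mul_pow_mul_conj_pow ha hb j k)).1
  simp_rw [← prod_weight_mul_prod_norm_sub_sq fun z =>
    ‖z‖ ^ (2 * a) * Real.exp (-b * ‖z‖ ^ 2)] at h
  exact h.re

theorem MeasureTheory.withDensity_ofReal_apply {α : Type*} [MeasurableSpace α] {μ : Measure α}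
    {f : α → ℝ} (hf : Integrable f μ) (hf0 : 0 ≤ f) {S : Set α} (hS : MeasurableSet S) :
    μ.withDensity (fun x => ENNReal.ofReal (f x)) S = ENNReal.ofReal (∫ x in S, f x ∂μ) := by
  rw [withDensity_apply _ hS,
    ofReal_integral_eq_lintegral_ofReal hf.restrict (ae_of_all _ hf0)]

/-- for the probability measure `μ` on `ℂⁿ` with density proportional to
`exp(-n Σ|zᵢ|²) (∏|zᵢ|)^{2(c-1)n} ∏_{i<j}|zᵢ-zⱼ|²`, the marginal distribution of the first
coordinate has density
`D_{n,1}(z) = (n^{(c-1)n}/π) Σ_{k<n} n^k |z|^{2(k+(c-1)n)}/Γ(k+(c-1)n+1) · e^{-n|z|²}`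
with respect to Lebesgue measure on `ℂ`. -/
theorem stmt_19 (c : ℝ) (hc : 1 ≤ c) (n : ℕ) (hn : 1 ≤ n)
    (μ : Measure (Fin n → ℂ)) [IsProbabilityMeasure μ]
    (K : ℝ) (hK : 0 < K)
    (hμ : μ = volume.withDensity (fun z : Fin n → ℂ =>
      ENNReal.ofReal (K * Real.exp (-(n : ℝ) * ∑ i, ‖z i‖ ^ 2) *
        (∏ i, ‖z i‖) ^ (2 * (c - 1) * (n : ℝ)) *
        ∏ i, ∏ j ∈ Finset.Ioi i, ‖z i - z j‖ ^ 2))) :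
    Measure.map (fun z : Fin n → ℂ => z ⟨0, by omega⟩) μ =
      volume.withDensity (fun z : ℂ =>
        ENNReal.ofReal (((n : ℝ) ^ ((c - 1) * (n : ℝ)) / Real.pi) *
          (∑ k ∈ Finset.range n,
            (n : ℝ) ^ k * ‖z‖ ^ (2 * ((k : ℝ) + (c - 1) * (n : ℝ))) /
              Real.Gamma ((k : ℝ) + (c - 1) * (n : ℝ) + 1)) *
          Real.exp (-(n : ℝ) * ‖z‖ ^ 2))) := by
  obtain ⟨m, rfl⟩ : ∃ m, n = m + 1 := ⟨n - 1, by omega⟩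
  set b : ℝ := ((m + 1 : ℕ) : ℝ) with hb_def
  set a : ℝ := (c - 1) * b with ha_def
  have hb : 0 < b := by positivity
  have ha : 0 ≤ a := mul_nonneg (by linarith) hb.le
  set h : ℕ → ℝ := fun k =>
    ∫ z : ℂ, ‖z‖ ^ (2 * a) * Real.exp (-b * ‖z‖ ^ 2) * ‖z‖ ^ (2 * k)
  have hh (k : ℕ) : h k = Real.pi * Real.Gamma (k + a + 1) / b ^ (k + a + 1) :=
    Complex.integral_norm_rpow_mul_exp_mul_norm_pow ha hb k
  have h_pos (k : ℕ) : 0 < h k := Complex.integral_norm_rpow_mul_exp_mul_norm_pow_pos ha hb k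
  have density_eq (z : Fin (m + 1) → ℂ) : K * Real.exp (-b * ∑ i, ‖z i‖ ^ 2) *
      (∏ i, ‖z i‖) ^ (2 * (c - 1) * b) * ∏ i, ∏ j ∈ Finset.Ioi i, ‖z i - z j‖ ^ 2 =
      K * ((∏ i, (‖z i‖ ^ (2 * a) * Real.exp (-b * ‖z i‖ ^ 2))) *
        ∏ i, ∏ j ∈ Finset.Ioi i, ‖z i - z j‖ ^ 2) := by
    rw [Finset.mul_sum, Real.exp_sum, mul_assoc 2, ← ha_def,
      ← Real.finsetProd_rpow _ _ fun i _ => norm_nonneg (z i), Finset.prod_mul_distrib]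
    ring
  have marginal_eq (z : ℂ) : b ^ a / Real.pi *
      (∑ k ∈ Finset.range (m + 1), b ^ k * ‖z‖ ^ (2 * ((k : ℝ) + a)) /
        Real.Gamma ((k : ℝ) + a + 1)) * Real.exp (-b * ‖z‖ ^ 2) =
      ∑ k : Fin (m + 1),
        ‖z‖ ^ (2 * a) * Real.exp (-b * ‖z‖ ^ 2) * ‖z‖ ^ (2 * (k : ℕ)) / (b * h k) := by
    rw [Finset.sum_range, Finset.mul_sum, Finset.sum_mul]
    refine Finset.sum_congr rfl fun k _ => ?_
    have hΓ := Real.Gamma_pos_of_pos (s := (k : ℕ) + a + 1) (by positivity)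
    have hba : 0 < b ^ a := Real.rpow_pos_of_pos hb a
    rw [hh, mul_add 2 ((k : ℕ) : ℝ) a,
      Real.rpow_add_of_nonneg (norm_nonneg z) (by positivity) (by positivity),
      show (2 : ℝ) * (k : ℕ) = ((2 * (k : ℕ) : ℕ) : ℝ) by push_cast; rfl, Real.rpow_natCast,
      Real.rpow_add hb, Real.rpow_add hb, Real.rpow_natCast, Real.rpow_one]
    field_simp
  have integrable_term (k : ℕ) : Integrable fun z : ℂ =>
      ‖z‖ ^ (2 * a) * Real.exp (-b * ‖z‖ ^ 2) * ‖z‖ ^ (2 * k) / (b * h k) :=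
    (Complex.integrable_norm_rpow_mul_exp_mul_norm_pow ha hb k).div_const _
  simp_rw [density_eq] at hμ
  simp_rw [marginal_eq]
  have eval_preimage {S : Set ℂ} (hS : MeasurableSet S) :
      μ (Function.eval 0 ⁻¹' S) = ENNReal.ofReal (K * (m.factorial * (∏ k : Fin (m + 1), h k) *
        ∑ k : Fin (m + 1), (∫ z in S,
          ‖z‖ ^ (2 * a) * Real.exp (-b * ‖z‖ ^ 2) * ‖z‖ ^ (2 * (k : ℕ))) / h k)) := by
    rw [hμ, withDensity_ofReal_apply
      ((Complex.integrable_weight_mul_prod_norm_sub_sq ha hb (m + 1)).const_mul K)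
      (fun z => by positivity) (measurableSet_preimage (measurable_pi_apply 0) hS), integral_const_mul,
      Complex.setIntegral_weight_mul_prod_norm_sub_sq ha hb]
  have normalization : K * (m.factorial * ∏ k : Fin (m + 1), h k) = 1 / b := by
    have huniv := eval_preimage MeasurableSet.univ
    rw [Set.preimage_univ, measure_univ] at huniv
    simp only [Measure.restrict_univ] at huniv
    have hone : ∑ k : Fin (m + 1), h k / h k = b := by
      simp [div_self (h_pos _).ne', hb_def]
    rw [show (∑ k : Fin (m + 1), (∫ z : ℂ,
      ‖z‖ ^ (2 * a) * Real.exp (-b * ‖z‖ ^ 2) * ‖z‖ ^ (2 * (k : ℕ))) / h k) = b from hone] at huniv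
    rw [eq_div_iff hb.ne', mul_assoc]
    exact ENNReal.ofReal_eq_one.mp huniv.symm
  ext S hS
  rw [Measure.map_apply (by fun_prop) hS, withDensity_ofReal_apply
    (integrable_finsetSum _ fun (k : Fin (m + 1)) _ => integrable_term k)
    (fun z => Finset.sum_nonneg fun k _ => by have := h_pos k; positivity) hS,
    integral_finsetSum _ fun (k : Fin (m + 1)) _ => (integrable_term k).restrict]
  refine (eval_preimage hS).trans ?_
  rw [← mul_assoc, normalization, Finset.mul_sum]
  congr 1
  refine Finset.sum_congr rfl fun k _ => ?_
  rw [integral_div]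
  have := (h_pos k).ne'
  field_simp
end
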